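/- Let k be a field of characteristic zero and 𝔤 a Lie algebra over k. Let U(𝔤) be the universal enveloping algebra with canonical map ι : 𝔤 → U(𝔤), and let Δ : U(𝔤) →ₐ[k] U(𝔤) ⊗[k] U(𝔤) be the unique k-algebra homomorphism satisfying Δ(ι(x)) = ι(x) ⊗ 1 + 1 ⊗ ι(x) for all x ∈ 𝔤 (obtained from the universal property of U(𝔤)). Then for a ∈ U(𝔤) one has Δ(a) = a ⊗ 1 + 1 ⊗ a if and only if a lies in the image of ι. That is, the primitive elements of U(𝔤) are exactly 𝔤. -/

import Mathlib

open scoped TensorProduct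

namespace PrimU

/-- Expansion of `(x + t y)^n` as a polynomial in `t`, with the linear coefficient identified. -/
lemma expand {k A : Type*} [Field k] [Ring A] [Algebra k A] (x y : A) (n : ℕ) :
    ∃ c : ℕ → A, (∀ t : k, (x + t • y) ^ n = ∑ i ∈ Finset.range (n + 2), t ^ i • c i) ∧
      c 0 = x ^ n ∧ c 1 = ∑ i ∈ Finset.range n, x ^ i * y * x ^ (n - 1 - i) ∧ c (n + 1) = 0 := by
  induction n with
  | zero =>
    refine ⟨fun i => if i = 0 then 1 else 0, ?_, ?_, ?_, ?_⟩ <;> simp [Finset.sum_range_succ]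
  | succ n ih =>
    obtain ⟨c, hc, h0, h1, h2⟩ := ih
    refine ⟨fun i => (if i < n + 2 then c i * x else 0) +
      (if i = 0 then 0 else c (i - 1) * y), ?_, ?_, ?_, ?_⟩
    · intro t
      rw [pow_succ, hc, mul_add]
      simp only [smul_add, Finset.sum_add_distrib]
      congr 1
      · rw [Finset.sum_range_succ _ (n + 2), Finset.sum_mul]
        simp only [lt_irrefl, if_false, smul_zero, add_zero]
        refine Finset.sum_congr rfl fun i hi => ?_
        rw [if_pos (Finset.mem_range.1 hi), smul_mul_assoc]
      · rw [Finset.sum_range_succ' _ (n + 2), Finset.sum_mul]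
        simp only [Nat.add_sub_cancel, if_true, smul_zero, add_zero, Nat.succ_ne_zero, if_false]
        refine Finset.sum_congr rfl fun i _ => ?_
        rw [smul_mul_smul_comm, pow_succ]
    · simp [h0, pow_succ]
    · simp only [h1, h0]
      rw [Finset.sum_range_succ, Finset.sum_mul]
      simp only [one_ne_zero, if_false, Nat.sub_self, h0]
      rw [if_pos (by omega)]
      simp only [Nat.add_sub_cancel, Nat.sub_self, pow_zero, mul_one]
      congr 1
      refine Finset.sum_congr rfl fun i hi => ?_
      have := Finset.mem_range.1 hi
      rw [mul_assoc, ← pow_succ]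
      congr 2
      omega
    · simp [h2]

/-- Polynomial functions with values in a subspace have coefficients in the subspace. -/
lemma coeff_mem {k A : Type*} [Field k] [CharZero k] [AddCommGroup A] [Module k A]
    (W : Submodule k A) (N : ℕ) (c : ℕ → A)
    (h : ∀ t : k, ∑ i ∈ Finset.range N, t ^ i • c i ∈ W) (j : ℕ) (hj : j < N) : c j ∈ W := by
  by_contra hn
  obtain ⟨φ, hφ, hW⟩ := Submodule.exists_le_ker_of_notMem hn
  have hp : (∑ i ∈ Finset.range N, Polynomial.monomial i (φ (c i))) = 0 := by
    apply Polynomial.funext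
    intro t
    have := hW (h t)
    rw [LinearMap.mem_ker, map_sum] at this
    rw [Polynomial.eval_finsetSum]
    simpa [mul_comm] using this
  have := congrArg (fun p => Polynomial.coeff p j) hp
  simp [Polynomial.coeff_monomial, hj] at this
  exact hφ (by simpa using this)

variable {k A : Type*} [Field k] [CharZero k] [Ring A] [Algebra k A]

/-- Span of the `n`-th powers of elements of `L`. -/
def V (L : Submodule k A) (n : ℕ) : Submodule k A := Submodule.span k (Set.image (fun x => x ^ n) (L : Set A))

lemma sand_mem (L : Submodule k A) (hL : ∀ x ∈ L, ∀ y ∈ L, x * y - y * x ∈ L)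
    (x : A) (hx : x ∈ L) (n : ℕ) :
    ∀ y ∈ L, ∀ i m, i + m = n → x ^ i * y * x ^ m ∈ ⨆ n, V L n := by
  induction n with
  | zero =>
    intro y hy i m him
    obtain ⟨rfl, rfl⟩ : i = 0 ∧ m = 0 := by omega
    refine Submodule.mem_iSup_of_mem 1 (Submodule.subset_span ⟨y, hy, ?_⟩)
    simp
  | succ n ih =>
    intro y hy
    set W := ⨆ n, V L n with hWdef
    have step : ∀ i ≤ n + 1, x ^ i * y * x ^ (n + 1 - i) - y * x ^ (n + 1) ∈ W := by
      intro i
      induction i with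
      | zero => intro _; simp
      | succ i ihi =>
        intro hi
        have h1 := ih _ (hL x hx y hy) i (n - i) (by omega)
        have h2 := ihi (by omega)
        have e : x ^ (i + 1) * y * x ^ (n + 1 - (i + 1)) - y * x ^ (n + 1) =
            x ^ i * (x * y - y * x) * x ^ (n - i) +
            (x ^ i * y * x ^ (n + 1 - i) - y * x ^ (n + 1)) := by
          rw [show n + 1 - (i + 1) = n - i by omega, show n + 1 - i = (n - i) + 1 by omega,
            pow_succ x i, pow_succ' x (n - i)]
          noncomm_ring
        rw [e]
        exact W.add_mem h1 h2
    obtain ⟨c, hc, -, h1, -⟩ := expand (k := k) x y (n + 2)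
    have hS : c 1 ∈ W := by
      refine coeff_mem W (n + 2 + 2) c (fun t => ?_) 1 (by omega)
      rw [← hc]
      exact Submodule.mem_iSup_of_mem (n + 2) (Submodule.subset_span
        ⟨_, L.add_mem hx (L.smul_mem t hy), rfl⟩)
    rw [h1] at hS
    have hD : ∑ i ∈ Finset.range (n + 2),
        (x ^ i * y * x ^ (n + 1 - i) - y * x ^ (n + 1)) ∈ W :=
      W.sum_mem fun i hi => step i (by have := Finset.mem_range.1 hi; omega)
    rw [Finset.sum_sub_distrib] at hD
    have h3 := W.sub_mem hS hD
    simp only [show n + 2 - 1 = n + 1 by omega, sub_sub_cancel, Finset.sum_const,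
      Finset.card_range] at h3
    rw [← Nat.cast_smul_eq_nsmul k, Submodule.smul_mem_iff _ (by norm_cast)] at h3
    intro i m him
    have h4 := W.add_mem (step i (by omega)) h3
    rwa [sub_add_cancel, show n + 1 - i = m by omega] at h4

lemma mul_mem (L : Submodule k A) (hL : ∀ x ∈ L, ∀ y ∈ L, x * y - y * x ∈ L)
    (y : A) (hy : y ∈ L) (w : A) (hw : w ∈ ⨆ n, V L n) : y * w ∈ ⨆ n, V L n := by
  have : (⨆ n, V L n) ≤ (⨆ n, V L n).comap (LinearMap.mulLeft k y) := by
    refine iSup_le fun n => Submodule.span_le.2 ?_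
    rintro _ ⟨x, hx, rfl⟩
    simpa using sand_mem L hL x hx n y hy 0 n (by omega)
  exact this hw

lemma adjoin_le (L : Submodule k A) (hL : ∀ x ∈ L, ∀ y ∈ L, x * y - y * x ∈ L)
    (u : A) (hu : u ∈ Algebra.adjoin k (L : Set A)) :
    ∀ w ∈ ⨆ n, V L n, u * w ∈ ⨆ n, V L n := by
  induction hu using Algebra.adjoin_induction with
  | mem x hx => exact fun w hw => mul_mem L hL x hx w hw
  | algebraMap r =>
    intro w hw
    rw [← Algebra.smul_def]
    exact Submodule.smul_mem _ _ hw
  | add a b _ _ ha hb =>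
    intro w hw
    rw [add_mul]
    exact Submodule.add_mem _ (ha w hw) (hb w hw)
  | mul a b _ _ ha hb =>
    intro w hw
    rw [mul_assoc]
    exact ha _ (hb w hw)

/-- If `A` is generated by `L`, it is spanned by powers of elements of `L`. -/
lemma iSup_eq_top (L : Submodule k A) (hL : ∀ x ∈ L, ∀ y ∈ L, x * y - y * x ∈ L)
    (hg : Algebra.adjoin k (L : Set A) = ⊤) : ⨆ n, V L n = ⊤ := by
  refine eq_top_iff.2 fun u _ => ?_
  have := adjoin_le L hL u (hg ▸ Algebra.mem_top) 1
    (Submodule.mem_iSup_of_mem 0 (Submodule.subset_span ⟨0, L.zero_mem, by simp⟩))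
  simpa using this

lemma main (L : Submodule k A) (hL : ∀ x ∈ L, ∀ y ∈ L, x * y - y * x ∈ L)
    (hg : Algebra.adjoin k (L : Set A) = ⊤) (Δ : A →ₐ[k] A ⊗[k] A)
    (hΔ : ∀ x ∈ L, Δ x = x ⊗ₜ[k] 1 + 1 ⊗ₜ[k] x) (a : A)
    (ha : Δ a = a ⊗ₜ[k] 1 + 1 ⊗ₜ[k] a) : a ∈ L := by
  let ψ : Module.End k A := LinearMap.mul' k A ∘ₗ Δ.toLinearMap
  let E : ℕ → Submodule k A := fun n => Module.End.eigenspace ψ ((2 : k) ^ n)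
  have hind : iSupIndep E := by
    refine (Module.End.eigenspaces_iSupIndep ψ).comp (f := fun n : ℕ => (2 : k) ^ n) ?_
    intro m n h
    have h' : ((2 ^ m : ℕ) : k) = ((2 ^ n : ℕ) : k) := by push_cast; exact h
    exact Nat.pow_right_injective le_rfl (Nat.cast_injective h')
  have hV : ∀ n, V L n ≤ E n := by
    intro n
    refine Submodule.span_le.2 ?_
    rintro _ ⟨x, hx, rfl⟩
    simp only [E, SetLike.mem_coe, Module.End.mem_eigenspace_iff]
    change LinearMap.mul' k A (Δ (x ^ n)) = _
    rw [map_pow, hΔ x hx, Commute.add_pow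
      (by simp [Commute, SemiconjBy, Algebra.TensorProduct.tmul_mul_tmul])]
    have e : ∀ m ∈ Finset.range (n + 1), LinearMap.mul' k A
        ((x ⊗ₜ[k] (1 : A)) ^ m * ((1 : A) ⊗ₜ[k] x) ^ (n - m) * ((n.choose m : ℕ) : A ⊗[k] A))
        = (n.choose m : k) • x ^ n := by
      intro m hm
      have := Finset.mem_range.1 hm
      rw [← nsmul_eq_mul', map_nsmul, Algebra.TensorProduct.tmul_pow,
        Algebra.TensorProduct.tmul_pow, Algebra.TensorProduct.tmul_mul_tmul,
        LinearMap.mul'_apply, Nat.cast_smul_eq_nsmul]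
      simp only [one_pow, mul_one, one_mul]
      rw [← pow_add]
      congr 2
      omega
    rw [map_sum, Finset.sum_congr rfl e, ← Finset.sum_smul, ← Nat.cast_sum, Nat.sum_range_choose]
    simp
  have ha' : a ∈ E 1 := by
    simp only [E, Module.End.mem_eigenspace_iff]
    change LinearMap.mul' k A (Δ a) = _
    rw [ha]
    simp [two_smul]
  have hV1 : V L 1 ≤ L := by
    refine Submodule.span_le.2 ?_
    rintro _ ⟨x, hx, rfl⟩
    simpa using hx
  have htop : a ∈ V L 1 ⊔ ⨆ n, ⨆ (_ : n ≠ 1), V L n := by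
    have hle : (⨆ n, V L n) ≤ V L 1 ⊔ ⨆ n, ⨆ (_ : n ≠ 1), V L n := by
      refine iSup_le fun n => ?_
      by_cases hn : n = 1
      · subst hn
        exact le_sup_left
      · exact le_sup_of_le_right (le_iSup₂_of_le n hn le_rfl)
    apply hle
    rw [iSup_eq_top L hL hg]
    trivial
  obtain ⟨b, hb, c, hc, rfl⟩ := Submodule.mem_sup.1 htop
  have hc' : c ∈ ⨆ n, ⨆ (_ : n ≠ 1), E n :=
    (iSup_mono fun n => iSup_mono fun _ => hV n) hc
  have hc1 : c ∈ E 1 := ((E 1).add_mem_iff_right (hV 1 hb)).1 ha'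
  have : c = 0 := Submodule.disjoint_def.1 (hind 1) c hc1 hc'
  rw [this, add_zero]
  exact hV1 hb

section
attribute [local instance] LieRing.ofAssociativeRing

/-- The image of `ι`, as a subspace. -/
def L0 (k : Type*) [Field k] (𝔤 : Type*) [LieRing 𝔤] [LieAlgebra k 𝔤] :
    Submodule k (UniversalEnvelopingAlgebra k 𝔤) :=
  LinearMap.range (UniversalEnvelopingAlgebra.ι k (L := 𝔤)).toLinearMap

lemma L0_comm (k : Type*) [Field k] (𝔤 : Type*) [LieRing 𝔤] [LieAlgebra k 𝔤] :
    ∀ x ∈ L0 k 𝔤, ∀ y ∈ L0 k 𝔤, x * y - y * x ∈ L0 k 𝔤 := by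
  rintro _ ⟨x, rfl⟩ _ ⟨y, rfl⟩
  exact ⟨⁅x, y⁆, (UniversalEnvelopingAlgebra.ι k (L := 𝔤)).map_lie x y⟩

end

end PrimU

/-- Let `k` be a field of characteristic zero, `𝔤` a Lie algebra over `k`,
and `U(𝔤)` its universal enveloping algebra with canonical map `ι`.  Let
`Δ : U(𝔤) →ₐ[k] U(𝔤) ⊗[k] U(𝔤)` be the algebra homomorphism determined (via the universal
property) by `Δ (ι x) = ι x ⊗ₜ 1 + 1 ⊗ₜ ι x`.  Then an element `a ∈ U(𝔤)` is primitive,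
i.e. `Δ a = a ⊗ₜ 1 + 1 ⊗ₜ a`, if and only if `a` lies in the image of `ι`:
the primitive elements of `U(𝔤)` are exactly `𝔤`. -/
theorem stmt5 (k : Type*) [Field k] [CharZero k]
    (𝔤 : Type*) [LieRing 𝔤] [LieAlgebra k 𝔤]
    (Δ : UniversalEnvelopingAlgebra k 𝔤 →ₐ[k]
      (UniversalEnvelopingAlgebra k 𝔤 ⊗[k] UniversalEnvelopingAlgebra k 𝔤))
    (hΔ : ∀ x : 𝔤, Δ (UniversalEnvelopingAlgebra.ι k x) =
      UniversalEnvelopingAlgebra.ι k x ⊗ₜ[k] 1 + 1 ⊗ₜ[k] UniversalEnvelopingAlgebra.ι k x)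
    (a : UniversalEnvelopingAlgebra k 𝔤) :
    Δ a = a ⊗ₜ[k] 1 + 1 ⊗ₜ[k] a ↔
      a ∈ Set.range (UniversalEnvelopingAlgebra.ι k (L := 𝔤)) := by
  constructor
  · intro ha
    have key := PrimU.main (PrimU.L0 k 𝔤) (PrimU.L0_comm k 𝔤) ?_ Δ ?_ a ha
    · obtain ⟨x, hx⟩ := key
      exact ⟨x, hx⟩
    · refine eq_top_iff.2 fun u _ => ?_
      obtain ⟨v, rfl⟩ : ∃ v, UniversalEnvelopingAlgebra.mkAlgHom k 𝔤 v = u :=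
        RingCon.mk'_surjective _ u
      induction v using TensorAlgebra.induction with
      | algebraMap r =>
        rw [AlgHom.commutes]
        exact Subalgebra.algebraMap_mem _ r
      | ι x => exact Algebra.subset_adjoin ⟨x, rfl⟩
      | mul a b ha hb =>
        rw [map_mul]
        exact mul_mem (ha trivial) (hb trivial)
      | add a b ha hb =>
        rw [map_add]
        exact add_mem (ha trivial) (hb trivial)
    · rintro _ ⟨x, rfl⟩
      exact hΔ x
  · rintro ⟨x, rfl⟩
    exact hΔ x
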